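/- There exists δ > 0 (which may depend on n, m, p, φ⁽⁰⁾, V and 𝒰) with the following property. Suppose |g|_{C^p(𝒰)} < δ and φ : V → ℝᵐ is a C^p map such that (φ(Y,W)+iY, W) ∈ 𝒰 and ρ_l(φ(Y,W)+iY, W) = 0 for all (Y,W) ∈ V and all l = 1,…,m. Then for every integer k ≤ p−1 and every C^{k+1} function u, defined (with variables (X,Y,W) ∈ ℝᵐ × ℝᵐ × ℂ^{n−m}) on an open set containing all points ((1−t)·φ⁽⁰⁾(Y,W) + t·φ(Y,W), Y, W) for t ∈ [0,1] and (Y,W) ∈ V, the function (Y,W) ↦ u(φ⁽⁰⁾(Y,W), Y, W) − u(φ(Y,W), Y, W) satisfies |u(φ⁽⁰⁾(·),·) − u(φ(·),·)|_{C^k(V)} ≤ C · |g|_{C^k(𝒰)} · (1 + |φ⁽⁰⁾|_{C^{k+1}(V′)})^N · |u|_{C^{k+1}}, where C > 0 and N ∈ ℕ depend only on n, m and k, and |u|_{C^{k+1}} is taken over the indicated domain of u. -/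

import Mathlib

open scoped ENNReal

/-- `‖u‖_{C^k(S)}`: the supremum over `x ∈ S` of the norms of the derivatives of `u`
of order at most `k`, taken within the set `S` (valued in `[0,∞]`). -/
noncomputable def CnormOn {E F : Type*} [NormedAddCommGroup E] [NormedSpace ℝ E]
    [NormedAddCommGroup F] [NormedSpace ℝ F]
    (u : E → F) (S : Set E) (k : ℕ) : ℝ≥0∞ :=
  ⨆ j : Fin (k + 1), ⨆ x ∈ S, ENNReal.ofReal ‖iteratedFDerivWithin ℝ j u S x‖

section DerivativeBounds

variable {E F G : Type*} [NormedAddCommGroup E] [NormedSpace ℝ E]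
  [NormedAddCommGroup F] [NormedSpace ℝ F] [NormedAddCommGroup G] [NormedSpace ℝ G]

theorem norm_iteratedFDerivWithin_id_le {s : Set E} (hs : UniqueDiffOn ℝ s) {x : E} (hx : x ∈ s)
    {i : ℕ} (hi : 1 ≤ i) : ‖iteratedFDerivWithin ℝ i (fun y : E => y) s x‖ ≤ 1 := by
  obtain ⟨j, rfl⟩ : ∃ j, i = j + 1 := ⟨i - 1, by omega⟩
  rw [← norm_iteratedFDerivWithin_fderivWithin hs hx]
  have hcongr : Set.EqOn (fderivWithin ℝ (fun y : E => y) s)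
      (fun _ => ContinuousLinearMap.id ℝ E) s := fun y hy => fderivWithin_fun_id (hs y hy)
  rw [iteratedFDerivWithin_congr hcongr hx]
  rcases Nat.eq_zero_or_pos j with rfl | hj
  · rw [norm_iteratedFDerivWithin_zero]
    exact ContinuousLinearMap.norm_id_le
  · rw [iteratedFDerivWithin_const_of_ne hj.ne']
    simp

theorem iteratedFDerivWithin_succ_comp_norm_eq {s : Set E} {t : Set F}
    (hs : UniqueDiffOn ℝ s) {f : F → G} {ψ : E → F} (hf : DifferentiableOn ℝ f t)
    (hψ : DifferentiableOn ℝ ψ s) (hst : Set.MapsTo ψ s t) {x : E} (hx : x ∈ s) (j : ℕ) :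
    ‖iteratedFDerivWithin ℝ (j + 1) (f ∘ ψ) s x‖ =
      ‖iteratedFDerivWithin ℝ j (fun y => ContinuousLinearMap.compL ℝ E F G
        ((fderivWithin ℝ f t ∘ ψ) y) (fderivWithin ℝ ψ s y)) s x‖ := by
  rw [← norm_iteratedFDerivWithin_fderivWithin hs hx]
  rw [iteratedFDerivWithin_congr (fun y hy => fderivWithin_comp y (hf _ (hst hy)) (hψ y hy) hst
    (hs y hy)) hx]
  rfl

/-- A bound on the derivative of order `j + 1` of a composition which isolates the contribution of
the top order derivative of the inner function. -/
theorem norm_iteratedFDerivWithin_succ_comp_le {s : Set E} {t : Set F}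
    (hs : UniqueDiffOn ℝ s) (ht : UniqueDiffOn ℝ t) {f : F → G} {ψ : E → F} {j : ℕ}
    (hf : ContDiffOn ℝ (j + 1) f t) (hψ : ContDiffOn ℝ (j + 1) ψ s) (hst : Set.MapsTo ψ s t)
    {x : E} (hx : x ∈ s) {M β : ℝ} (hβ : 1 ≤ β)
    (hM : ∀ i ≤ j + 1, ‖iteratedFDerivWithin ℝ i f t (ψ x)‖ ≤ M)
    (hψβ : ∀ i, 1 ≤ i → i ≤ j → ‖iteratedFDerivWithin ℝ i ψ s x‖ ≤ β) :
    ‖iteratedFDerivWithin ℝ (j + 1) (f ∘ ψ) s x‖ ≤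
      ‖fderivWithin ℝ f t (ψ x)‖ * ‖iteratedFDerivWithin ℝ (j + 1) ψ s x‖ +
        2 ^ j * j.factorial * M * β ^ (j + 1) := by
  have hM0 : 0 ≤ M := (norm_nonneg _).trans (hM 0 (by omega))
  have hβ0 : 0 ≤ β := zero_le_one.trans hβ
  have hf' : ContDiffOn ℝ j (fderivWithin ℝ f t) t := hf.fderivWithin ht le_rfl
  have hψ' : ContDiffOn ℝ j (fderivWithin ℝ ψ s) s := hψ.fderivWithin hs le_rfl
  have hψj : ContDiffOn ℝ j ψ s := hψ.of_le (by exact_mod_cast j.le_succ)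
  rw [iteratedFDerivWithin_succ_comp_norm_eq hs (hf.differentiableOn (by simp))
    (hψ.differentiableOn (by simp)) hst hx]
  refine (ContinuousLinearMap.norm_iteratedFDerivWithin_le_of_bilinear_of_le_one _
    (hf'.comp hψj hst) hψ' hs hx le_rfl (ContinuousLinearMap.norm_compL_le ℝ E F G)).trans ?_
  rw [Finset.sum_range_succ', add_comm]
  refine add_le_add ?_ ?_
  · rw [norm_iteratedFDerivWithin_zero, norm_iteratedFDerivWithin_fderivWithin hs hx]
    simp
  · have hterm : ∀ i ∈ Finset.range j,
        (j.choose (i + 1) : ℝ) * ‖iteratedFDerivWithin ℝ (i + 1) (fderivWithin ℝ f t ∘ ψ) s x‖ *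
          ‖iteratedFDerivWithin ℝ (j - (i + 1)) (fderivWithin ℝ ψ s) s x‖ ≤
        (j.choose (i + 1) : ℝ) * (j.factorial * M * β ^ (j + 1)) := by
      intro i hi
      have hij : i + 1 ≤ j := by simpa using hi
      have h₁ : ‖iteratedFDerivWithin ℝ (i + 1) (fderivWithin ℝ f t ∘ ψ) s x‖ ≤
          (i + 1).factorial * M * β ^ (i + 1) := by
        refine norm_iteratedFDerivWithin_comp_le hf' hψj (by exact_mod_cast hij) ht hs hst hx
          (fun l hl => ?_) (fun l hl hl' => ?_)
        · rw [norm_iteratedFDerivWithin_fderivWithin ht (hst hx)]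
          exact hM _ (by omega)
        · exact (hψβ l hl (hl'.trans hij)).trans (le_self_pow₀ hβ (by omega))
      have h₂ : ‖iteratedFDerivWithin ℝ (j - (i + 1)) (fderivWithin ℝ ψ s) s x‖ ≤ β := by
        rw [norm_iteratedFDerivWithin_fderivWithin hs hx]
        exact hψβ _ (by omega) (by omega)
      rw [mul_assoc]
      refine mul_le_mul_of_nonneg_left ?_ (by positivity)
      calc _ ≤ ((i + 1).factorial * M * β ^ (i + 1)) * β :=
            mul_le_mul h₁ h₂ (norm_nonneg _) (by positivity)
        _ = (i + 1).factorial * M * β ^ (i + 2) := by ring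
        _ ≤ j.factorial * M * β ^ (j + 1) := by
            refine mul_le_mul (mul_le_mul_of_nonneg_right ?_ hM0)
              (pow_le_pow_right₀ hβ (by omega)) (by positivity) (by positivity)
            exact_mod_cast Nat.factorial_le hij
    refine (Finset.sum_le_sum hterm).trans ?_
    rw [← Finset.sum_mul, mul_assoc (2 ^ j : ℝ), mul_assoc (2 ^ j : ℝ)]
    refine mul_le_mul_of_nonneg_right ?_ (by positivity)
    have := Nat.sum_range_choose j
    rw [Finset.sum_range_succ'] at this
    exact_mod_cast (by omega : ∑ i ∈ Finset.range j, j.choose (i + 1) ≤ 2 ^ j)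

theorem norm_iteratedFDerivWithin_compL_le {s : Set E} (hs : UniqueDiffOn ℝ s) {x : E}
    (hx : x ∈ s) {j : ℕ} {A : E → F →L[ℝ] G} {B : E → E →L[ℝ] F} (hA : ContDiffOn ℝ j A s)
    (hB : ContDiffOn ℝ j B s) {K : ℝ}
    (hK : ∀ i ≤ j, ‖iteratedFDerivWithin ℝ i A s x‖ * ‖iteratedFDerivWithin ℝ (j - i) B s x‖ ≤ K) :
    ‖iteratedFDerivWithin ℝ j (fun y => ContinuousLinearMap.compL ℝ E F G (A y) (B y)) s x‖ ≤
      2 ^ j * K := by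
  refine (ContinuousLinearMap.norm_iteratedFDerivWithin_le_of_bilinear_of_le_one _ hA hB hs hx
    le_rfl (ContinuousLinearMap.norm_compL_le ℝ E F G)).trans ?_
  have hsum : (2 : ℝ) ^ j = ∑ i ∈ Finset.range (j + 1), (j.choose i : ℝ) := by
    exact_mod_cast (Nat.sum_range_choose j).symm
  rw [hsum, Finset.sum_mul]
  refine Finset.sum_le_sum fun i hi => ?_
  rw [mul_assoc]
  exact mul_le_mul_of_nonneg_left (hK i (by simpa [Nat.lt_succ_iff] using hi)) (by positivity)

theorem norm_comp_sub_comp_le {t : Set F} (ht : UniqueDiffOn ℝ t) {f : F → G} {a b : E → F} {x : E}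
    (hf : ContDiffOn ℝ 1 f t) (hseg : segment ℝ (a x) (b x) ⊆ t) {M η : ℝ}
    (hM : ∀ z ∈ t, ‖iteratedFDerivWithin ℝ 1 f t z‖ ≤ M) {s : Set E}
    (hη : ‖iteratedFDerivWithin ℝ 0 (a - b) s x‖ ≤ η) :
    ‖(f ∘ a - f ∘ b) x‖ ≤ M * η := by
  have hM0 : 0 ≤ M := (norm_nonneg _).trans (hM _ (hseg (left_mem_segment ℝ _ _)))
  have h := (convex_segment (𝕜 := ℝ) (a x) (b x)).norm_image_sub_le_of_norm_hasFDerivWithin_le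
    (f := f) (f' := fderivWithin ℝ f t) (C := M)
    (fun z hz => ((hf.differentiableOn (by simp)) z (hseg hz)).hasFDerivWithinAt.mono hseg)
    (fun z hz => by
      rw [← norm_iteratedFDerivWithin_one f (ht z (hseg hz))]
      exact hM z (hseg hz))
    (right_mem_segment ℝ _ _) (left_mem_segment ℝ _ _)
  rw [norm_iteratedFDerivWithin_zero] at hη
  exact h.trans (mul_le_mul_of_nonneg_left hη hM0)

end DerivativeBounds

section CompSub

universe v w

/-- The difference of the compositions of `f` with two inner functions is controlled by the
difference of the inner functions, at the cost of one derivative of `f`. -/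
theorem exists_norm_iteratedFDerivWithin_comp_sub_comp_le (k : ℕ) :
    ∃ c : ℝ, 1 ≤ c ∧ ∀ j ≤ k, ∀ {E : Type v} {F G : Type w}
      [NormedAddCommGroup E] [NormedSpace ℝ E] [NormedAddCommGroup F] [NormedSpace ℝ F]
      [NormedAddCommGroup G] [NormedSpace ℝ G] {s : Set E} {t : Set F} {f : F → G} {a b : E → F}
      {x : E} {M β η : ℝ}, UniqueDiffOn ℝ s → UniqueDiffOn ℝ t → ContDiffOn ℝ (j + 1) f t →
      ContDiffOn ℝ j a s → ContDiffOn ℝ j b s → Set.MapsTo a s t → Set.MapsTo b s t → x ∈ s →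
      segment ℝ (a x) (b x) ⊆ t → 1 ≤ β →
      (∀ i ≤ j + 1, ∀ z ∈ t, ‖iteratedFDerivWithin ℝ i f t z‖ ≤ M) →
      (∀ i, 1 ≤ i → i ≤ j → ‖iteratedFDerivWithin ℝ i a s x‖ ≤ β) →
      (∀ i, 1 ≤ i → i ≤ j → ‖iteratedFDerivWithin ℝ i b s x‖ ≤ β) →
      (∀ i ≤ j, ‖iteratedFDerivWithin ℝ i (a - b) s x‖ ≤ η) →
      ‖iteratedFDerivWithin ℝ j (f ∘ a - f ∘ b) s x‖ ≤ c * M * β ^ j * η := by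
  induction k with
  | zero =>
    refine ⟨1, le_rfl, fun j hj => ?_⟩
    obtain rfl : j = 0 := by omega
    intro E F G _ _ _ _ _ _ s t f a b x M β η hs ht hf _ _ hast hbst hx hseg _ hM _ _ hη
    simpa using norm_comp_sub_comp_le ht (by simpa using hf) hseg
      (fun z hz => hM 1 le_rfl z hz) (hη 0 le_rfl)
  | succ k ih =>
    obtain ⟨c, hc, ih⟩ := ih
    have hfac : (1 : ℝ) ≤ k.factorial := by exact_mod_cast k.factorial_pos
    have hpow : (1 : ℝ) ≤ 2 ^ k := one_le_pow₀ one_le_two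
    have hc' : 1 ≤ 2 ^ k * (c + k.factorial) := by nlinarith
    refine ⟨2 ^ k * (c + k.factorial), hc', fun j hj => ?_⟩
    intro E F G _ _ _ _ _ _ s t f a b x M β η hs ht hf ha hb hast hbst hx hseg hβ hM haβ hbβ hη
    have hM0 : 0 ≤ M := (norm_nonneg _).trans (hM 0 (by omega) (a x) (hast hx))
    have hη0 : 0 ≤ η := (norm_nonneg _).trans (hη 0 (by omega))
    have hβ0 : 0 ≤ β := zero_le_one.trans hβ
    rcases Nat.eq_zero_or_pos j with rfl | hj0
    · have h := norm_comp_sub_comp_le ht (f := f) (by simpa using hf) hseg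
        (fun z hz => hM 1 le_rfl z hz) (hη 0 le_rfl)
      rw [norm_iteratedFDerivWithin_zero, pow_zero, mul_one, mul_assoc]
      exact h.trans (le_mul_of_one_le_left (by positivity) hc')
    obtain ⟨i, rfl⟩ : ∃ i, j = i + 1 := ⟨j - 1, by omega⟩
    have hik : i ≤ k := by omega
    have hf' : ContDiffOn ℝ (i + 1) (fderivWithin ℝ f t) t :=
      hf.fderivWithin ht (by push_cast; exact le_rfl)
    have ha' : ContDiffOn ℝ i (fderivWithin ℝ a s) s :=
      ha.fderivWithin hs (by push_cast; exact le_rfl)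
    have hab' : ContDiffOn ℝ i (fderivWithin ℝ (a - b) s) s :=
      (ha.sub hb).fderivWithin hs (by push_cast; exact le_rfl)
    have hai : ContDiffOn ℝ i a s := ha.of_le (by exact_mod_cast i.le_succ)
    have hbi : ContDiffOn ℝ i b s := hb.of_le (by exact_mod_cast i.le_succ)
    have hf'i : ContDiffOn ℝ i (fderivWithin ℝ f t) t :=
      hf'.of_le (by exact_mod_cast i.le_succ)
    have hfa := hf'i.comp hai hast
    have hfb := hf'i.comp hbi hbst
    have hcongr : Set.EqOn (fderivWithin ℝ (f ∘ a - f ∘ b) s)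
        ((fun y => ContinuousLinearMap.compL ℝ E F G
            ((fderivWithin ℝ f t ∘ a - fderivWithin ℝ f t ∘ b) y) (fderivWithin ℝ a s y)) +
          fun y => ContinuousLinearMap.compL ℝ E F G
            ((fderivWithin ℝ f t ∘ b) y) (fderivWithin ℝ (a - b) s y)) s := by
      intro y hy
      have hfd : DifferentiableOn ℝ f t := hf.differentiableOn (by simp)
      have had := ha.differentiableOn (by simp) y hy
      have hbd := hb.differentiableOn (by simp) y hy
      have hfad := hfd _ (hast hy)
      have hfbd := hfd _ (hbst hy)
      rw [fderivWithin_sub (hs y hy) (hfad.comp y had hast) (hfbd.comp y hbd hbst),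
        fderivWithin_comp y hfad had hast (hs y hy), fderivWithin_comp y hfbd hbd hbst (hs y hy)]
      simp only [Pi.add_apply, Pi.sub_apply, Function.comp_apply,
        fderivWithin_sub (hs y hy) had hbd, ContinuousLinearMap.compL_apply,
        ContinuousLinearMap.sub_comp, ContinuousLinearMap.comp_sub]
      abel
    have hd₁ : ContDiffOn ℝ i (fun y => ContinuousLinearMap.compL ℝ E F G
        ((fderivWithin ℝ f t ∘ a - fderivWithin ℝ f t ∘ b) y) (fderivWithin ℝ a s y)) s :=
      (hfa.sub hfb).clm_comp ha'
    have hd₂ : ContDiffOn ℝ i (fun y => ContinuousLinearMap.compL ℝ E F G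
        ((fderivWithin ℝ f t ∘ b) y) (fderivWithin ℝ (a - b) s y)) s :=
      hfb.clm_comp hab'
    rw [← norm_iteratedFDerivWithin_fderivWithin hs hx, iteratedFDerivWithin_congr hcongr hx,
      iteratedFDerivWithin_add_apply (hd₁ x hx) (hd₂ x hx) hs hx]
    have h₁ : ‖iteratedFDerivWithin ℝ i (fun y => ContinuousLinearMap.compL ℝ E F G
        ((fderivWithin ℝ f t ∘ a - fderivWithin ℝ f t ∘ b) y) (fderivWithin ℝ a s y)) s x‖ ≤
        2 ^ i * (c * M * β ^ (i + 1) * η) := by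
      refine norm_iteratedFDerivWithin_compL_le hs hx (hfa.sub hfb) ha' fun l hl => ?_
      have hd : ‖iteratedFDerivWithin ℝ l
          (fderivWithin ℝ f t ∘ a - fderivWithin ℝ f t ∘ b) s x‖ ≤ c * M * β ^ l * η := by
        have hli : (l : WithTop ℕ∞) ≤ i := by exact_mod_cast hl
        refine ih l (hl.trans hik) hs ht (hf'.of_le (by gcongr)) (hai.of_le hli) (hbi.of_le hli)
          hast hbst hx hseg hβ (fun r hr z hz => ?_) (fun r hr hr' => haβ r hr (by omega))
          (fun r hr hr' => hbβ r hr (by omega)) (fun r hr => hη r (by omega))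
        rw [norm_iteratedFDerivWithin_fderivWithin ht hz]
        exact hM _ (by omega) z hz
      rw [norm_iteratedFDerivWithin_fderivWithin hs hx]
      calc _ ≤ (c * M * β ^ l * η) * β :=
            mul_le_mul hd (haβ _ (by omega) (by omega)) (norm_nonneg _) (by positivity)
        _ = c * M * β ^ (l + 1) * η := by ring
        _ ≤ c * M * β ^ (i + 1) * η := by
            have := pow_le_pow_right₀ hβ (Nat.succ_le_succ hl)
            gcongr
    have h₂ : ‖iteratedFDerivWithin ℝ i (fun y => ContinuousLinearMap.compL ℝ E F G
        ((fderivWithin ℝ f t ∘ b) y) (fderivWithin ℝ (a - b) s y)) s x‖ ≤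
        2 ^ i * (k.factorial * M * β ^ (i + 1) * η) := by
      refine norm_iteratedFDerivWithin_compL_le hs hx hfb hab' fun l hl => ?_
      have hd : ‖iteratedFDerivWithin ℝ l (fderivWithin ℝ f t ∘ b) s x‖ ≤
          l.factorial * M * β ^ l := by
        refine norm_iteratedFDerivWithin_comp_le hf'i hbi (by exact_mod_cast hl) ht hs hbst hx
          (fun r hr => ?_) (fun r hr hr' => ?_)
        · rw [norm_iteratedFDerivWithin_fderivWithin ht (hbst hx)]
          exact hM _ (by omega) _ (hbst hx)
        · exact (hbβ r hr (by omega)).trans (le_self_pow₀ hβ (by omega))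
      rw [norm_iteratedFDerivWithin_fderivWithin hs hx]
      calc _ ≤ (l.factorial * M * β ^ l) * η :=
            mul_le_mul hd (hη _ (by omega)) (norm_nonneg _) (by positivity)
        _ ≤ k.factorial * M * β ^ (i + 1) * η := by
            have h₃ := pow_le_pow_right₀ hβ (hl.trans i.le_succ)
            have h₄ : (l.factorial : ℝ) ≤ k.factorial := by
              exact_mod_cast Nat.factorial_le (hl.trans hik)
            gcongr
    calc _ ≤ 2 ^ i * (c * M * β ^ (i + 1) * η) + 2 ^ i * (k.factorial * M * β ^ (i + 1) * η) :=
          (norm_add_le _ _).trans (add_le_add h₁ h₂)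
      _ = 2 ^ i * (c + k.factorial) * M * β ^ (i + 1) * η := by ring
      _ ≤ 2 ^ k * (c + k.factorial) * M * β ^ (i + 1) * η := by
          have := pow_le_pow_right₀ (one_le_two (α := ℝ)) hik
          gcongr

end CompSub

section PerturbedGraph

universe u

variable {X Q : Type u} [NormedAddCommGroup X] [NormedSpace ℝ X]
  [NormedAddCommGroup Q] [NormedSpace ℝ Q]

theorem norm_iteratedFDerivWithin_graph_le {V : Set Q} (hV : UniqueDiffOn ℝ V) {i : ℕ} {φ : Q → X}
    (hφ : ContDiffOn ℝ i φ V) {x : Q} (hx : x ∈ V) (hi : 1 ≤ i) :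
    ‖iteratedFDerivWithin ℝ i (fun q => (φ q, q)) V x‖ ≤
      max ‖iteratedFDerivWithin ℝ i φ V x‖ 1 := by
  rw [iteratedFDerivWithin_prodMk (hφ x hx) contDiff_fun_id.contDiffWithinAt hV hx le_rfl,
    ContinuousMultilinearMap.opNorm_prod]
  exact max_le_max le_rfl (norm_iteratedFDerivWithin_id_le hV hx hi)

theorem norm_iteratedFDerivWithin_fst_le {E : Type*} [NormedAddCommGroup E] [NormedSpace ℝ E]
    {V : Set E} (hV : UniqueDiffOn ℝ V) {i : ℕ} {h : E → X × Q} (hh : ContDiffOn ℝ i h V)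
    {x : E} (hx : x ∈ V) :
    ‖iteratedFDerivWithin ℝ i (fun q => (h q).1) V x‖ ≤ ‖iteratedFDerivWithin ℝ i h V x‖ :=
  ((ContinuousLinearMap.fst ℝ X Q).norm_iteratedFDerivWithin_comp_left (hh x hx) hV hx
    le_rfl).trans (mul_le_of_le_one_left (norm_nonneg _) (ContinuousLinearMap.norm_fst_le ..))

theorem norm_iteratedFDerivWithin_snd_le {E : Type*} [NormedAddCommGroup E] [NormedSpace ℝ E]
    {V : Set E} (hV : UniqueDiffOn ℝ V) {i : ℕ} {h : E → X × Q} (hh : ContDiffOn ℝ i h V)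
    {x : E} (hx : x ∈ V) :
    ‖iteratedFDerivWithin ℝ i (fun q => (h q).2) V x‖ ≤ ‖iteratedFDerivWithin ℝ i h V x‖ :=
  ((ContinuousLinearMap.snd ℝ X Q).norm_iteratedFDerivWithin_comp_left (hh x hx) hV hx
    le_rfl).trans (mul_le_of_le_one_left (norm_nonneg _) (ContinuousLinearMap.norm_snd_le ..))

theorem norm_iteratedFDerivWithin_id_add_snd_le {V : Set Q} (hV : UniqueDiffOn ℝ V) {i : ℕ}
    {h : Q → X × Q} (hh : ContDiffOn ℝ i h V) {x : Q} (hx : x ∈ V) (hi : 1 ≤ i) :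
    ‖iteratedFDerivWithin ℝ i (fun q => q + (h q).2) V x‖ ≤
      1 + ‖iteratedFDerivWithin ℝ i h V x‖ := by
  change ‖iteratedFDerivWithin ℝ i ((fun q => q) + fun q => (h q).2) V x‖ ≤ _
  rw [iteratedFDerivWithin_add_apply contDiff_fun_id.contDiffWithinAt (hh.snd x hx) hV hx]
  exact (norm_add_le _ _).trans (add_le_add (norm_iteratedFDerivWithin_id_le hV hx hi)
    (norm_iteratedFDerivWithin_snd_le hV hh hx))

/-- The graph of `φ` over `V` is cut out by the equation
`φ q + g₁ (φ q, q) = φ₀ (q + g₂ (φ q, q))`, where the derivatives of `φ₀` of order at most `k + 1`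
are bounded by `A`, those of `g` of order at most `k` by `γ`, and `g` is so small in `C¹` that the
equation can be differentiated and solved for the derivatives of `φ`. -/
structure IsPerturbedGraph (k : ℕ) (V V' : Set Q) (U : Set (X × Q)) (φ₀ φ : Q → X)
    (g : X × Q → X × Q) (A γ : ℝ) : Prop where
  isOpen_domain : IsOpen V
  isOpen_base : IsOpen V'
  isOpen_ambient : IsOpen U
  contDiffOn_base : ContDiffOn ℝ (k + 1) φ₀ V'
  contDiffOn_perturbation : ContDiffOn ℝ k g U
  contDiffOn_graph : ContDiffOn ℝ k φ V
  mapsTo_graph : Set.MapsTo (fun q => (φ q, q)) V U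
  segment_subset : ∀ q ∈ V, segment ℝ q (q + (g (φ q, q)).2) ⊆ V'
  eq_base : ∀ q ∈ V, φ q + (g (φ q, q)).1 = φ₀ (q + (g (φ q, q)).2)
  one_le : 1 ≤ A
  le_one : γ ≤ 1
  norm_base_le : ∀ i ≤ k + 1, ∀ z ∈ V', ‖iteratedFDerivWithin ℝ i φ₀ V' z‖ ≤ A
  norm_perturbation_le : ∀ i ≤ k, ∀ z ∈ U, ‖iteratedFDerivWithin ℝ i g U z‖ ≤ γ
  small : ∃ δ, (∀ z ∈ U, ‖fderivWithin ℝ g U z‖ ≤ δ) ∧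
    ∀ q ∈ V, (1 + ‖fderivWithin ℝ φ₀ V' (q + (g (φ q, q)).2)‖) * δ ≤ 1 / 2

namespace IsPerturbedGraph

variable {V V' : Set Q} {U : Set (X × Q)} {φ₀ φ : Q → X} {g : X × Q → X × Q} {A γ : ℝ}

theorem mapsTo_shift {k : ℕ} (h : IsPerturbedGraph k V V' U φ₀ φ g A γ) :
    Set.MapsTo (fun q => q + (g (φ q, q)).2) V V' :=
  fun q hq => h.segment_subset q hq (right_mem_segment ℝ _ _)

theorem subset_base {k : ℕ} (h : IsPerturbedGraph k V V' U φ₀ φ g A γ) : V ⊆ V' :=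
  fun q hq => h.segment_subset q hq (left_mem_segment ℝ _ _)

theorem of_le {j k : ℕ} (h : IsPerturbedGraph k V V' U φ₀ φ g A γ) (hjk : j ≤ k) :
    IsPerturbedGraph j V V' U φ₀ φ g A γ where
  __ := h
  contDiffOn_base := h.contDiffOn_base.of_le (by gcongr)
  contDiffOn_perturbation := h.contDiffOn_perturbation.of_le (by exact_mod_cast hjk)
  contDiffOn_graph := h.contDiffOn_graph.of_le (by exact_mod_cast hjk)
  norm_base_le i hi := h.norm_base_le i (by omega)
  norm_perturbation_le i hi := h.norm_perturbation_le i (by omega)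

theorem norm_perturbation_comp_le {k : ℕ} (h : IsPerturbedGraph k V V' U φ₀ φ g A γ) {x : Q}
    (hx : x ∈ V) {β : ℝ} (hβ : 1 ≤ β) {j : ℕ} (hjk : j ≤ k)
    (hβb : ∀ i, 1 ≤ i → i ≤ j → ‖iteratedFDerivWithin ℝ i (fun q => (φ q, q)) V x‖ ≤ β)
    {i : ℕ} (hi : i ≤ j) :
    ‖iteratedFDerivWithin ℝ i (g ∘ fun q => (φ q, q)) V x‖ ≤ j.factorial * γ * β ^ j := by
  have hγ : 0 ≤ γ :=
    (norm_nonneg _).trans (h.norm_perturbation_le 0 (by omega) _ (h.mapsTo_graph hx))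
  refine (norm_iteratedFDerivWithin_comp_le (n := i) (C := γ) (D := β) h.contDiffOn_perturbation
    (h.contDiffOn_graph.prodMk contDiffOn_id) (by exact_mod_cast hi.trans hjk)
    h.isOpen_ambient.uniqueDiffOn h.isOpen_domain.uniqueDiffOn h.mapsTo_graph hx
    (fun l hl => h.norm_perturbation_le l (by omega) _ (h.mapsTo_graph hx))
    (fun l hl hl' => (hβb l hl (by omega)).trans (le_self_pow₀ hβ (by omega)))).trans ?_
  have h₁ := pow_le_pow_right₀ hβ hi
  have h₂ : (i.factorial : ℝ) ≤ j.factorial := by exact_mod_cast Nat.factorial_le hi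
  gcongr

variable (X Q) in
/-- If the perturbation `g` is small in `C¹`, the top order derivatives of `φ` can be absorbed in
the equation `φ q + g₁ (φ q, q) = φ₀ (q + g₂ (φ q, q))`. -/
theorem exists_norm_iteratedFDerivWithin_succ_graph_le (j : ℕ) :
    ∃ K : ℝ, 1 ≤ K ∧ ∀ {V V' : Set Q} {U : Set (X × Q)} {φ₀ φ : Q → X} {g : X × Q → X × Q}
      {A γ : ℝ}, IsPerturbedGraph (j + 1) V V' U φ₀ φ g A γ → ∀ {x : Q} {β : ℝ}, x ∈ V → 1 ≤ β →
      (∀ i, 1 ≤ i → i ≤ j → ‖iteratedFDerivWithin ℝ i (fun q => (φ q, q)) V x‖ ≤ β) →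
      ‖iteratedFDerivWithin ℝ (j + 1) (fun q => (φ q, q)) V x‖ ≤ K * A * β ^ ((j + 1) ^ 2) := by
  set c : ℝ := 2 ^ j * j.factorial with hc
  have hc0 : 0 ≤ c := by positivity
  have hfac : (1 : ℝ) ≤ j.factorial := by exact_mod_cast j.factorial_pos
  refine ⟨2 * (2 + 2 * c + c * (2 * j.factorial) ^ (j + 1)), ?_, ?_⟩
  · have : 0 ≤ c * (2 * (j.factorial : ℝ)) ^ (j + 1) := by positivity
    linarith
  intro V V' U φ₀ φ g A γ h x β hx hβ hβb
  have hV := h.isOpen_domain.uniqueDiffOn (𝕜 := ℝ)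
  have hV' := h.isOpen_base.uniqueDiffOn (𝕜 := ℝ)
  have hφ₀ : ContDiffOn ℝ (j + 1) φ₀ V' :=
    h.contDiffOn_base.of_le (by exact_mod_cast (j + 1).le_succ)
  have hg : ContDiffOn ℝ (j + 1) g U := by exact_mod_cast h.contDiffOn_perturbation
  have hφ : ContDiffOn ℝ (j + 1) φ V := by exact_mod_cast h.contDiffOn_graph
  have hgb : ∀ i ≤ j + 1, ∀ z ∈ U, ‖iteratedFDerivWithin ℝ i g U z‖ ≤ 1 := fun i hi z hz =>
    (h.norm_perturbation_le i hi z hz).trans h.le_one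
  have hA := h.one_le
  obtain ⟨δ, hδ, hδ'⟩ := h.small
  set Φ : Q → X × Q := fun q => (φ q, q) with hΦdef
  set Γ : Q → Q := fun q => q + ((g ∘ Φ) q).2 with hΓdef
  have hΦ : Set.MapsTo Φ V U := h.mapsTo_graph
  have hΓ : Set.MapsTo Γ V V' := h.mapsTo_shift
  have hsmall : (1 + ‖fderivWithin ℝ φ₀ V' (Γ x)‖) * δ ≤ 1 / 2 := hδ' x hx
  have hβ0 : 0 ≤ β := zero_le_one.trans hβ
  have hΦd : ContDiffOn ℝ (j + 1) Φ V := hφ.prodMk contDiffOn_id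
  have hHd : ContDiffOn ℝ (j + 1) (g ∘ Φ) V := hg.comp hΦd hΦ
  have hΓd : ContDiffOn ℝ (j + 1) Γ V := contDiffOn_id.add hHd.snd
  have hHd' : ∀ i ≤ j + 1, ContDiffOn ℝ i (g ∘ Φ) V := fun i hi =>
    hHd.of_le (by exact_mod_cast hi)
  set y := ‖iteratedFDerivWithin ℝ (j + 1) Φ V x‖ with hy
  set b := ‖fderivWithin ℝ φ₀ V' (Γ x)‖ with hb
  have hb0 : 0 ≤ b := norm_nonneg _
  have hy0 : 0 ≤ y := norm_nonneg _
  have hbA : b ≤ A := by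
    rw [hb, ← norm_iteratedFDerivWithin_one φ₀ (hV' _ (hΓ hx))]
    exact h.norm_base_le 1 (by omega) _ (hΓ hx)
  have hHtop : ‖iteratedFDerivWithin ℝ (j + 1) (g ∘ Φ) V x‖ ≤ δ * y + c * β ^ (j + 1) := by
    have h := norm_iteratedFDerivWithin_succ_comp_le hV h.isOpen_ambient.uniqueDiffOn hg hΦd hΦ hx hβ
      (fun i hi => hgb i hi _ (hΦ hx)) hβb
    rw [mul_one] at h
    exact h.trans (by gcongr; exact hδ _ (hΦ hx))
  have hHlow : ∀ i, 1 ≤ i → i ≤ j →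
      ‖iteratedFDerivWithin ℝ i (g ∘ Φ) V x‖ ≤ j.factorial * β ^ j := by
    intro i hi hij
    refine (h.norm_perturbation_comp_le hx hβ j.le_succ hβb hij).trans ?_
    rw [mul_right_comm]
    exact mul_le_of_le_one_right (by positivity) h.le_one
  have hΓtop : ‖iteratedFDerivWithin ℝ (j + 1) Γ V x‖ ≤ 1 + (δ * y + c * β ^ (j + 1)) :=
    (norm_iteratedFDerivWithin_id_add_snd_le hV (hHd' _ le_rfl) hx (by omega)).trans (by gcongr)
  have hone : 1 ≤ j.factorial * β ^ j := one_le_mul_of_one_le_of_one_le hfac (one_le_pow₀ hβ)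
  have hΓlow : ∀ i, 1 ≤ i → i ≤ j →
      ‖iteratedFDerivWithin ℝ i Γ V x‖ ≤ 2 * j.factorial * β ^ j := by
    intro i hi hij
    have h := norm_iteratedFDerivWithin_id_add_snd_le hV (hHd' i (by omega)) hx hi
    have h' := hHlow i hi hij
    linarith
  have hcomp : ‖iteratedFDerivWithin ℝ (j + 1) (φ₀ ∘ Γ) V x‖ ≤
      b * (1 + (δ * y + c * β ^ (j + 1))) + c * A * (2 * j.factorial * β ^ j) ^ (j + 1) := by
    have h := norm_iteratedFDerivWithin_succ_comp_le hV hV' hφ₀ hΓd hΓ hx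
      (by linarith : 1 ≤ 2 * j.factorial * β ^ j) (fun i hi => h.norm_base_le i (by omega) _ (hΓ hx)) hΓlow
    exact h.trans (by gcongr)
  have hφtop : ‖iteratedFDerivWithin ℝ (j + 1) φ V x‖ ≤
      b * (1 + (δ * y + c * β ^ (j + 1))) + c * A * (2 * j.factorial * β ^ j) ^ (j + 1) +
        (δ * y + c * β ^ (j + 1)) := by
    have hEq : Set.EqOn φ (φ₀ ∘ Γ - fun q => ((g ∘ Φ) q).1) V := fun q hq =>
      eq_sub_of_add_eq (h.eq_base q hq)
    rw [iteratedFDerivWithin_congr hEq hx, iteratedFDerivWithin_sub_apply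
      (by exact_mod_cast hφ₀.comp hΓd hΓ x hx) (by exact_mod_cast hHd.fst x hx) hV hx]
    exact (norm_sub_le _ _).trans (add_le_add hcomp
      ((norm_iteratedFDerivWithin_fst_le hV (hHd' _ le_rfl) hx).trans hHtop))
  have hytop : y ≤ ‖iteratedFDerivWithin ℝ (j + 1) φ V x‖ + 1 :=
    (norm_iteratedFDerivWithin_graph_le hV (by exact_mod_cast hφ) hx (by omega)).trans
      (max_le (by linarith) (by linarith [norm_nonneg (iteratedFDerivWithin ℝ (j + 1) φ V x)]))
  set P := β ^ ((j + 1) ^ 2) with hP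
  have hP1 : 1 ≤ P := one_le_pow₀ hβ
  have hP2 : β ^ (j + 1) ≤ P := pow_le_pow_right₀ hβ (by nlinarith)
  have hP3 : (2 * j.factorial * β ^ j) ^ (j + 1) ≤ (2 * j.factorial) ^ (j + 1) * P := by
    rw [mul_pow, ← pow_mul]
    exact mul_le_mul_of_nonneg_left (pow_le_pow_right₀ hβ (by nlinarith)) (by positivity)
  have hsmall' : (1 + b) * δ * y ≤ 1 / 2 * y := mul_le_mul_of_nonneg_right hsmall hy0
  have e₁ : 1 + b ≤ 2 * (A * P) := by nlinarith
  have e₂ : (1 + b) * (c * β ^ (j + 1)) ≤ (2 * A) * (c * P) := by gcongr; linarith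
  have e₃ : c * A * (2 * j.factorial * β ^ j) ^ (j + 1) ≤
      c * A * ((2 * j.factorial) ^ (j + 1) * P) := by gcongr
  have : y / 2 ≤ 2 * (A * P) + (2 * A) * (c * P) + c * A * ((2 * j.factorial) ^ (j + 1) * P) := by
    linarith
  linarith

variable (X Q) in
theorem exists_norm_iteratedFDerivWithin_graph_le (k : ℕ) :
    ∃ C : ℝ, ∃ N : ℕ, 1 ≤ C ∧ ∀ {V V' : Set Q} {U : Set (X × Q)} {φ₀ φ : Q → X}
      {g : X × Q → X × Q} {A γ : ℝ}, IsPerturbedGraph k V V' U φ₀ φ g A γ → ∀ {x : Q}, x ∈ V →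
      ∀ i, 1 ≤ i → i ≤ k →
        ‖iteratedFDerivWithin ℝ i (fun q => (φ q, q)) V x‖ ≤ C * A ^ N := by
  induction k with
  | zero => exact ⟨1, 0, le_rfl, by intros; omega⟩
  | succ k ih =>
    obtain ⟨C, N, hC, ih⟩ := ih
    obtain ⟨K, hK, hstep⟩ := exists_norm_iteratedFDerivWithin_succ_graph_le X Q k
    set L := (k + 1) ^ 2
    have hCL : C ≤ C ^ L := le_self_pow₀ hC (by positivity)
    refine ⟨K * C ^ L, 1 + N * L, one_le_mul_of_one_le_of_one_le hK (one_le_pow₀ hC), ?_⟩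
    intro V V' U φ₀ φ g A γ h x hx i hi hik
    have hA := h.one_le
    have hβ : 1 ≤ C * A ^ N := one_le_mul_of_one_le_of_one_le hC (one_le_pow₀ hA)
    have hlow := ih (h.of_le k.le_succ) hx
    have hKA : 1 ≤ K * A := one_le_mul_of_one_le_of_one_le hK hA
    have heq : K * A * (C * A ^ N) ^ L = K * C ^ L * A ^ (1 + N * L) := by ring
    rw [← heq]
    rcases hik.lt_or_eq with hlt | rfl
    · exact (hlow i hi (by omega)).trans ((le_self_pow₀ hβ (by positivity)).trans
        (le_mul_of_one_le_left (by positivity) hKA))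
    · exact hstep h hx hβ hlow

variable (X Q) in
theorem exists_norm_iteratedFDerivWithin_base_sub_graph_le (k : ℕ) :
    ∃ C : ℝ, ∃ N : ℕ, 1 ≤ C ∧ ∀ {V V' : Set Q} {U : Set (X × Q)} {φ₀ φ : Q → X}
      {g : X × Q → X × Q} {A γ : ℝ}, IsPerturbedGraph k V V' U φ₀ φ g A γ → ∀ {x : Q}, x ∈ V →
      ∀ i ≤ k, ‖iteratedFDerivWithin ℝ i (φ₀ - φ) V x‖ ≤ C * A ^ N * γ := by
  obtain ⟨C, N, hC, hgraph⟩ := exists_norm_iteratedFDerivWithin_graph_le X Q k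
  obtain ⟨c, hc, hcomp⟩ := exists_norm_iteratedFDerivWithin_comp_sub_comp_le k
  have hfac : (1 : ℝ) ≤ k.factorial := by exact_mod_cast k.factorial_pos
  refine ⟨(c * (2 * k.factorial * C ^ k) ^ k + 1) * (k.factorial * C ^ k), 1 + N * k * k + N * k,
    one_le_mul_of_one_le_of_one_le (le_add_of_nonneg_left (by positivity))
      (one_le_mul_of_one_le_of_one_le hfac (one_le_pow₀ hC)), ?_⟩
  intro V V' U φ₀ φ g A γ h x hx i hi
  have hA := h.one_le
  have hV := h.isOpen_domain.uniqueDiffOn (𝕜 := ℝ)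
  have hV' := h.isOpen_base.uniqueDiffOn (𝕜 := ℝ)
  have hγ : 0 ≤ γ :=
    (norm_nonneg _).trans (h.norm_perturbation_le 0 (by omega) _ (h.mapsTo_graph hx))
  set β := C * A ^ N with hβdef
  have hβ : 1 ≤ β := one_le_mul_of_one_le_of_one_le hC (one_le_pow₀ hA)
  have hβ0 : 0 ≤ β := zero_le_one.trans hβ
  set Φ : Q → X × Q := fun q => (φ q, q)
  set H : Q → X × Q := g ∘ Φ
  set Γ : Q → Q := fun q => q + (H q).2 with hΓdef
  have hΦd : ContDiffOn ℝ k Φ V := h.contDiffOn_graph.prodMk contDiffOn_id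
  have hHd : ContDiffOn ℝ k H V := h.contDiffOn_perturbation.comp hΦd h.mapsTo_graph
  have hHd' : ∀ l ≤ k, ContDiffOn ℝ l H V := fun l hl => hHd.of_le (by exact_mod_cast hl)
  have hΓd : ContDiffOn ℝ k Γ V := contDiffOn_id.add hHd.snd
  have hH : ∀ l ≤ k, ‖iteratedFDerivWithin ℝ l H V x‖ ≤ k.factorial * γ * β ^ k := fun l hl =>
    h.norm_perturbation_comp_le hx hβ le_rfl (hgraph h hx) hl
  have hone : 1 ≤ k.factorial * β ^ k := one_le_mul_of_one_le_of_one_le hfac (one_le_pow₀ hβ)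
  have hH1 : k.factorial * γ * β ^ k ≤ k.factorial * β ^ k := by
    rw [mul_right_comm]
    exact mul_le_of_le_one_right (by positivity) h.le_one
  have hΓone : 1 ≤ 2 * k.factorial * β ^ k := by linarith
  have hfirst : ‖iteratedFDerivWithin ℝ i (φ₀ ∘ (fun q => q) - φ₀ ∘ Γ) V x‖ ≤
      c * A * (2 * k.factorial * β ^ k) ^ i * (k.factorial * γ * β ^ k) := by
    refine hcomp i hi (a := fun q => q) hV hV' (h.contDiffOn_base.of_le (by gcongr)) contDiffOn_id
      (hΓd.of_le (by exact_mod_cast hi)) h.subset_base h.mapsTo_shift hx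
      (h.segment_subset x hx) hΓone (fun l hl => h.norm_base_le l (by omega))
      (fun l hl _ => (norm_iteratedFDerivWithin_id_le hV hx hl).trans hΓone)
      (fun l hl hli => ?_) (fun l hl => ?_)
    · have h₁ := norm_iteratedFDerivWithin_id_add_snd_le hV (hHd' l (by omega)) hx hl
      have h₂ := hH l (by omega)
      linarith
    · have heq : (fun q => q) - Γ = -fun q => (H q).2 := by
        ext1 q
        simp [hΓdef]
      rw [heq, iteratedFDerivWithin_neg_apply hV hx, norm_neg]
      exact (norm_iteratedFDerivWithin_snd_le hV (hHd' l (by omega)) hx).trans (hH l (by omega))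
  have hEq : Set.EqOn (φ₀ - φ) ((φ₀ ∘ (fun q => q) - φ₀ ∘ Γ) + fun q => (H q).1) V := by
    intro q hq
    have := h.eq_base q hq
    simp only [Pi.sub_apply, Pi.add_apply, Function.comp_apply]
    rw [show φ₀ (Γ q) = φ q + (H q).1 from this.symm]
    abel
  have hi' : (i : WithTop ℕ∞) ≤ k := by exact_mod_cast hi
  have hφ₀i : ContDiffOn ℝ i φ₀ V' :=
    h.contDiffOn_base.of_le (by exact_mod_cast hi.trans k.le_succ)
  have hd : ContDiffOn ℝ i (φ₀ ∘ (fun q => q) - φ₀ ∘ Γ) V :=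
    (hφ₀i.comp contDiffOn_id h.subset_base).sub (hφ₀i.comp (hΓd.of_le hi') h.mapsTo_shift)
  rw [iteratedFDerivWithin_congr hEq hx, iteratedFDerivWithin_add_apply (hd x hx)
    ((hHd' i hi).fst x hx) hV hx]
  have hpow := pow_le_pow_right₀ hΓone hi
  have hAk : 1 ≤ A * (A ^ (N * k * k)) := one_le_mul_of_one_le_of_one_le hA (one_le_pow₀ hA)
  calc _ ≤ c * A * (2 * k.factorial * β ^ k) ^ i * (k.factorial * γ * β ^ k) +
        k.factorial * γ * β ^ k := (norm_add_le _ _).trans (add_le_add hfirst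
          ((norm_iteratedFDerivWithin_fst_le hV (hHd' i hi) hx).trans (hH i hi)))
    _ ≤ c * A * (2 * k.factorial * β ^ k) ^ k * (k.factorial * γ * β ^ k) +
        A * A ^ (N * k * k) * (k.factorial * γ * β ^ k) := by
        refine add_le_add (by gcongr) (le_mul_of_one_le_left (by positivity) hAk)
    _ = _ := by
        rw [hβdef]
        ring

variable (X Q) in
theorem exists_norm_iteratedFDerivWithin_restriction_sub_le (k : ℕ) :
    ∃ C : ℝ, ∃ N : ℕ, 1 ≤ C ∧ ∀ {G : Type u} [NormedAddCommGroup G] [NormedSpace ℝ G]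
      {V V' : Set Q} {U O : Set (X × Q)} {φ₀ φ : Q → X} {g : X × Q → X × Q} {f : X × Q → G}
      {A γ M : ℝ}, IsPerturbedGraph k V V' U φ₀ φ g A γ → IsOpen O → ContDiffOn ℝ (k + 1) f O →
      (∀ q ∈ V, segment ℝ (φ₀ q, q) (φ q, q) ⊆ O) →
      (∀ i ≤ k + 1, ∀ z ∈ O, ‖iteratedFDerivWithin ℝ i f O z‖ ≤ M) → ∀ {x : Q}, x ∈ V →
      ∀ i ≤ k, ‖iteratedFDerivWithin ℝ i (fun q => f (φ₀ q, q) - f (φ q, q)) V x‖ ≤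
        C * γ * A ^ N * M := by
  obtain ⟨C, N, hC, hgraph⟩ := exists_norm_iteratedFDerivWithin_graph_le X Q k
  obtain ⟨C', N', hC', hsub⟩ := exists_norm_iteratedFDerivWithin_base_sub_graph_le X Q k
  obtain ⟨c, hc, hcomp⟩ := exists_norm_iteratedFDerivWithin_comp_sub_comp_le k
  refine ⟨c * C ^ k * C', (N + 1) * k + N', one_le_mul_of_one_le_of_one_le
    (one_le_mul_of_one_le_of_one_le hc (one_le_pow₀ hC)) hC', ?_⟩
  intro G _ _ V V' U O φ₀ φ g f A γ M h hO hf hseg hM x hx i hi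
  have hA := h.one_le
  have hV := h.isOpen_domain.uniqueDiffOn (𝕜 := ℝ)
  have hV' := h.isOpen_base.uniqueDiffOn (𝕜 := ℝ)
  have hγ : 0 ≤ γ :=
    (norm_nonneg _).trans (h.norm_perturbation_le 0 (by omega) _ (h.mapsTo_graph hx))
  have hM0 : 0 ≤ M := (norm_nonneg _).trans
    (hM 0 (by omega) _ (hseg x hx (left_mem_segment ℝ _ _)))
  set β := C * A ^ (N + 1)
  have hβ : 1 ≤ β := one_le_mul_of_one_le_of_one_le hC (one_le_pow₀ hA)
  have hβ0 : 0 ≤ β := zero_le_one.trans hβ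
  have hAβ : A ≤ β := (le_self_pow₀ hA (by omega)).trans
    (le_mul_of_one_le_left (by positivity) hC)
  have hi' : (i : WithTop ℕ∞) ≤ k := by exact_mod_cast hi
  have hφ₀ : ContDiffOn ℝ k φ₀ V :=
    (h.contDiffOn_base.of_le (by exact_mod_cast k.le_succ)).mono h.subset_base
  have hφ₀i := hφ₀.of_le hi'
  have hφi := h.contDiffOn_graph.of_le hi'
  refine (hcomp i hi (f := f) (a := fun q => (φ₀ q, q)) (b := fun q => (φ q, q)) (β := β)
    (η := C' * A ^ N' * γ) hV hO.uniqueDiffOn (hf.of_le (by gcongr)) (hφ₀i.prodMk contDiffOn_id)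
    (hφi.prodMk contDiffOn_id) (fun q hq => hseg q hq (left_mem_segment ℝ _ _))
    (fun q hq => hseg q hq (right_mem_segment ℝ _ _)) hx (hseg x hx) hβ
    (fun l hl => hM l (by omega)) (fun l hl hli => ?_) (fun l hl hli => ?_)
    (fun l hl => ?_)).trans ?_
  · have hl' : (l : WithTop ℕ∞) ≤ k := by exact_mod_cast hli.trans hi
    refine (norm_iteratedFDerivWithin_graph_le hV (hφ₀.of_le hl') hx hl).trans (max_le ?_ hβ)
    rw [iteratedFDerivWithin_subset h.subset_base hV hV' (h.contDiffOn_base.of_le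
      (by exact_mod_cast (hli.trans hi).trans k.le_succ)) hx]
    exact (h.norm_base_le l (by omega) x (h.subset_base hx)).trans hAβ
  · refine (hgraph h hx l hl (hli.trans hi)).trans ?_
    have := pow_le_pow_right₀ hA N.le_succ
    exact mul_le_mul_of_nonneg_left this (by positivity)
  · have heq : ((fun q => (φ₀ q, q)) - fun q => (φ q, q)) =
        ContinuousLinearMap.inl ℝ X Q ∘ (φ₀ - φ) := by
      ext1 q
      simp
    have hl' : (l : WithTop ℕ∞) ≤ k := by exact_mod_cast hl.trans hi
    rw [heq]
    exact (((ContinuousLinearMap.inl ℝ X Q).norm_iteratedFDerivWithin_comp_left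
      ((hφ₀.sub h.contDiffOn_graph) x hx) hV hx hl').trans
      (mul_le_of_le_one_left (norm_nonneg _) (ContinuousLinearMap.norm_inl_le_one ..))).trans
      (hsub h hx l (hl.trans hi))
  · have hpow := pow_le_pow_right₀ hβ hi
    calc _ ≤ c * M * β ^ k * (C' * A ^ N' * γ) := by gcongr
      _ = _ := by ring

end IsPerturbedGraph

end PerturbedGraph

section CnormOn

variable {E F : Type*} [NormedAddCommGroup E] [NormedSpace ℝ E]
  [NormedAddCommGroup F] [NormedSpace ℝ F] {f : E → F} {S : Set E} {k : ℕ}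

theorem CnormOn_le_ofReal {M : ℝ} (h : ∀ i ≤ k, ∀ x ∈ S, ‖iteratedFDerivWithin ℝ i f S x‖ ≤ M) :
    CnormOn f S k ≤ ENNReal.ofReal M :=
  iSup_le fun i => iSup₂_le fun x hx => ENNReal.ofReal_le_ofReal (h i (by omega) x hx)

theorem ofReal_norm_iteratedFDerivWithin_le_CnormOn {i : ℕ} (hi : i ≤ k) {x : E} (hx : x ∈ S) :
    ENNReal.ofReal ‖iteratedFDerivWithin ℝ i f S x‖ ≤ CnormOn f S k :=
  le_iSup_of_le (⟨i, by omega⟩ : Fin (k + 1)) (le_iSup₂_of_le x hx le_rfl)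

theorem norm_iteratedFDerivWithin_le_toReal_CnormOn (h : CnormOn f S k ≠ ⊤) {i : ℕ} (hi : i ≤ k)
    {x : E} (hx : x ∈ S) : ‖iteratedFDerivWithin ℝ i f S x‖ ≤ (CnormOn f S k).toReal :=
  (ENNReal.ofReal_le_iff_le_toReal h).1 (ofReal_norm_iteratedFDerivWithin_le_CnormOn hi hx)

theorem CnormOn_mono {j : ℕ} (hjk : j ≤ k) : CnormOn f S j ≤ CnormOn f S k :=
  iSup_le fun i => iSup₂_le fun _ hx =>
    ofReal_norm_iteratedFDerivWithin_le_CnormOn (by omega) hx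

theorem eqOn_zero_of_CnormOn_eq_zero (h : CnormOn f S k = 0) : Set.EqOn f 0 S := by
  intro x hx
  have := norm_iteratedFDerivWithin_le_toReal_CnormOn (f := f) (S := S) (k := k) (by simp [h])
    (Nat.zero_le k) hx
  simpa [h] using this

theorem CnormOn_eq_zero (h : Set.EqOn f 0 S) : CnormOn f S k = 0 := by
  refine le_antisymm ?_ zero_le
  rw [← ENNReal.ofReal_zero]
  refine CnormOn_le_ofReal fun i _ x hx => ?_
  rw [iteratedFDerivWithin_congr h hx, iteratedFDerivWithin_zero]
  simp

end CnormOn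

theorem exists_pos_ball_subset_and_fderivWithin_le {Q X : Type*} [NormedAddCommGroup Q]
    [NormedSpace ℝ Q] [ProperSpace Q] [NormedAddCommGroup X] [NormedSpace ℝ X] {V V' : Set Q}
    (hV : Bornology.IsBounded V) (hV' : IsOpen V') (hVV' : closure V ⊆ V') {φ₀ : Q → X}
    (hφ₀ : ContDiffOn ℝ 1 φ₀ V') :
    ∃ δ > 0, δ ≤ 1 ∧ ∀ q ∈ V, ∀ w, ‖w - q‖ ≤ δ →
      w ∈ V' ∧ (1 + ‖fderivWithin ℝ φ₀ V' w‖) * δ ≤ 1 / 2 := by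
  obtain ⟨ε, hε, hεV⟩ := hV.isCompact_closure.exists_cthickening_subset_open hV' hVV'
  obtain ⟨B, hB⟩ := (hV.isCompact_closure.cthickening (r := ε)).exists_bound_of_continuousOn
    ((hφ₀.continuousOn_fderivWithin hV'.uniqueDiffOn le_rfl).mono hεV)
  have hB1 : 1 ≤ 1 + |B| := by linarith [abs_nonneg B]
  have hpos : 0 < 1 / (2 * (1 + |B|)) := by positivity
  refine ⟨min ε (1 / (2 * (1 + |B|))), lt_min hε hpos, (min_le_right _ _).trans ?_, ?_⟩
  · rw [div_le_one (by positivity)]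
    linarith
  intro q hq w hw
  have hwmem : w ∈ Metric.cthickening ε (closure V) :=
    Metric.mem_cthickening_of_dist_le w q ε _ (subset_closure hq)
      (by rw [dist_eq_norm]; exact hw.trans (min_le_left _ _))
  refine ⟨hεV hwmem, ?_⟩
  calc _ ≤ (1 + |B|) * (1 / (2 * (1 + |B|))) :=
        mul_le_mul (by linarith [hB w hwmem, le_abs_self B]) (min_le_right _ _)
          (lt_min hε hpos).le (by positivity)
    _ = 1 / 2 := by field_simp

/-- **Comparison of restrictions to two nearby graphs.**
Points of `ℂⁿ` are written `z = (X + iY, W)`, modelled as `(X, (Y, W))` with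
`X, Y ∈ ℝᵐ`, `W ∈ ℂ^{n-m}`.  `M₀` is the graph `X = φ⁽⁰⁾(Y,W)` over `V'`, with defining
functions `ρ⁽⁰⁾_l(z) = X_l - φ⁽⁰⁾_l(Y,W)`, and `ρ_l(z) = ρ⁽⁰⁾_l(z + g z)`.  There are
constants `C k > 0`, `N k` depending only on `n, m, k`, and `δ > 0` (possibly depending on
everything else), such that whenever `|g|_{C^p(𝒰)} < δ`, `φ : V → ℝᵐ` is a `C^p` map whose
graph lies in `𝒰` and satisfies `ρ_l(φ(Y,W) + iY, W) = 0`, then for every `k ≤ p - 1` and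
every `C^{k+1}` function `u(X,Y,W)` defined on an open set `O` containing all the points
`((1-t)φ⁽⁰⁾(Y,W) + tφ(Y,W), Y, W)`, `t ∈ [0,1]`, `(Y,W) ∈ V`:
`|u(φ⁽⁰⁾(·),·) - u(φ(·),·)|_{C^k(V)}
  ≤ C k · |g|_{C^k(𝒰)} · (1 + |φ⁽⁰⁾|_{C^{k+1}(V')})^{N k} · |u|_{C^{k+1}(O)}`. -/
theorem graph_restriction_comparison (n m p : ℕ) (hm : 1 ≤ m) (hmn : m < n) :
    ∃ C : ℕ → ℝ, ∃ N : ℕ → ℕ, (∀ k, 0 < C k) ∧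
    ∀ (V V' : Set ((Fin m → ℝ) × (Fin (n - m) → ℂ))),
      IsOpen V → Bornology.IsBounded V → IsOpen V' → closure V ⊆ V' →
    ∀ φ0 : (Fin m → ℝ) × (Fin (n - m) → ℂ) → Fin m → ℝ,
      ContDiffOn ℝ p φ0 V' →
    ∀ 𝒰 : Set ((Fin m → ℝ) × ((Fin m → ℝ) × (Fin (n - m) → ℂ))),
      IsOpen 𝒰 → Bornology.IsBounded 𝒰 →
      -- `𝒰` contains the graph `M₀` of `φ⁽⁰⁾` over `V'`
      (∀ q ∈ V', (φ0 q, q) ∈ 𝒰) →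
      ∃ δ > (0 : ℝ),
        ∀ g : (Fin m → ℝ) × ((Fin m → ℝ) × (Fin (n - m) → ℂ)) →
              (Fin m → ℝ) × ((Fin m → ℝ) × (Fin (n - m) → ℂ)),
          ContDiffOn ℝ p g 𝒰 →
          -- `z + g z ∈ Ω = ℝᵐ × V'` for all `z ∈ 𝒰`
          (∀ z ∈ 𝒰, (z + g z).2 ∈ V') →
          CnormOn g 𝒰 p < ENNReal.ofReal δ →
          ∀ φ : (Fin m → ℝ) × (Fin (n - m) → ℂ) → Fin m → ℝ,
            ContDiffOn ℝ p φ V →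
            -- the graph of `φ` over `V` lies in `𝒰` and `ρ_l` vanishes on it,
            -- i.e. `ρ⁽⁰⁾(z + g z) = 0` at `z = (φ q, q)`
            (∀ q ∈ V, (φ q, q) ∈ 𝒰 ∧
              ((φ q, q) + g (φ q, q)).1 = φ0 (((φ q, q) + g (φ q, q)).2)) →
            ∀ k : ℕ, k + 1 ≤ p →
              ∀ O : Set ((Fin m → ℝ) × ((Fin m → ℝ) × (Fin (n - m) → ℂ))),
                IsOpen O →
                (∀ t ∈ Set.Icc (0 : ℝ) 1, ∀ q ∈ V,
                  ((1 - t) • φ0 q + t • φ q, q) ∈ O) →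
                ∀ u : (Fin m → ℝ) × ((Fin m → ℝ) × (Fin (n - m) → ℂ)) → ℝ,
                  ContDiffOn ℝ (k + 1) u O →
                  CnormOn (fun q => u (φ0 q, q) - u (φ q, q)) V k ≤
                    ENNReal.ofReal (C k) * CnormOn g 𝒰 k *
                      (1 + CnormOn φ0 V' (k + 1)) ^ (N k) * CnormOn u O (k + 1) := by
  choose C N hC hmain using fun k =>
    IsPerturbedGraph.exists_norm_iteratedFDerivWithin_restriction_sub_le
      (Fin m → ℝ) ((Fin m → ℝ) × (Fin (n - m) → ℂ)) k
  refine ⟨C, fun k => N k + 1, fun k => zero_lt_one.trans_le (hC k), ?_⟩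
  intro V V' hVo hVb hV'o hVV' φ0 hφ0 U hU _ _
  rcases Nat.eq_zero_or_pos p with rfl | hp
  · exact ⟨1, one_pos, by intros; omega⟩
  obtain ⟨δ, hδ, hδ1, hball⟩ := exists_pos_ball_subset_and_fderivWithin_le hVb hV'o hVV'
    (hφ0.of_le (by exact_mod_cast hp))
  refine ⟨δ, hδ, ?_⟩
  intro g hg _ hgδ φ hφ hgraph k hk O hO hseg u hu
  have hgδ' : ∀ i ≤ p, ∀ z ∈ U, ‖iteratedFDerivWithin ℝ i g U z‖ ≤ δ := fun i hi z hz =>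
    (ENNReal.ofReal_le_ofReal_iff hδ.le).1
      ((ofReal_norm_iteratedFDerivWithin_le_CnormOn hi hz).trans hgδ.le)
  have hG : CnormOn g U k ≠ ⊤ :=
    (((CnormOn_mono (by omega)).trans_lt hgδ).trans ENNReal.ofReal_lt_top).ne
  by_cases hG0 : CnormOn g U k = 0
  · rw [CnormOn_eq_zero fun q hq => ?_]
    · exact zero_le
    · obtain ⟨hqU, heq⟩ := hgraph q hq
      have hgq : g (φ q, q) = 0 := eqOn_zero_of_CnormOn_eq_zero hG0 hqU
      have : φ q = φ0 q := by simpa [hgq] using heq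
      simp [this]
  by_cases hu0 : CnormOn u O (k + 1) = 0
  · rw [CnormOn_eq_zero fun q hq => ?_]
    · exact zero_le
    · have h₀ : u (φ0 q, q) = 0 :=
        eqOn_zero_of_CnormOn_eq_zero hu0 (by simpa using hseg 0 (by simp) q hq)
      have h₁ : u (φ q, q) = 0 :=
        eqOn_zero_of_CnormOn_eq_zero hu0 (by simpa using hseg 1 (by simp) q hq)
      simp [h₀, h₁]
  have hC0 : ENNReal.ofReal (C k) ≠ 0 := by
    simpa using zero_lt_one.trans_le (hC k)
  by_cases hA : CnormOn φ0 V' (k + 1) = ⊤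
  · rw [hA, add_top, ENNReal.top_pow (Nat.succ_ne_zero _), ENNReal.mul_top (mul_ne_zero hC0 hG0),
      ENNReal.top_mul hu0]
    exact le_top
  by_cases huT : CnormOn u O (k + 1) = ⊤
  · rw [huT, ENNReal.mul_top (mul_ne_zero (mul_ne_zero hC0 hG0) (pow_ne_zero _ (by simp)))]
    exact le_top
  set A := 1 + (CnormOn φ0 V' (k + 1)).toReal with hAdef
  have hA1 : 1 ≤ A := le_add_of_nonneg_right ENNReal.toReal_nonneg
  have hshift : ∀ q ∈ V, ∀ w ∈ segment ℝ q (q + (g (φ q, q)).2), ‖w - q‖ ≤ δ := by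
    intro q hq w hw
    have h := norm_sub_le_of_mem_segment hw
    rw [add_sub_cancel_left] at h
    refine h.trans ((norm_snd_le _).trans ?_)
    have := hgδ' 0 (by omega) _ (hgraph q hq).1
    rwa [norm_iteratedFDerivWithin_zero] at this
  have hpert : IsPerturbedGraph k V V' U φ0 φ g A (CnormOn g U k).toReal :=
    { isOpen_domain := hVo
      isOpen_base := hV'o
      isOpen_ambient := hU
      contDiffOn_base := hφ0.of_le (by exact_mod_cast hk)
      contDiffOn_perturbation := hg.of_le (by exact_mod_cast (Nat.le_succ k).trans hk)
      contDiffOn_graph := hφ.of_le (by exact_mod_cast (Nat.le_succ k).trans hk)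
      mapsTo_graph := fun q hq => (hgraph q hq).1
      segment_subset := fun q hq w hw => (hball q hq w (hshift q hq w hw)).1
      eq_base := fun q hq => (hgraph q hq).2
      one_le := hA1
      le_one := by
        refine ENNReal.toReal_le_of_le_ofReal zero_le_one ?_
        exact (CnormOn_mono (by omega)).trans (hgδ.le.trans (ENNReal.ofReal_le_ofReal hδ1))
      norm_base_le := fun i hi z hz =>
        (norm_iteratedFDerivWithin_le_toReal_CnormOn hA hi hz).trans
          (le_add_of_nonneg_left zero_le_one)
      norm_perturbation_le := fun i hi z hz =>
        norm_iteratedFDerivWithin_le_toReal_CnormOn hG hi hz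
      small := by
        refine ⟨δ, fun z hz => ?_, fun q hq =>
          (hball q hq _ (hshift q hq _ (right_mem_segment ℝ _ _))).2⟩
        rw [← norm_iteratedFDerivWithin_one g (hU.uniqueDiffOn z hz)]
        exact hgδ' 1 hp z hz }
  have hseg' : ∀ q ∈ V, segment ℝ (φ0 q, q) (φ q, q) ⊆ O := by
    intro q hq z hz
    rw [segment_eq_image] at hz
    obtain ⟨t, ht, rfl⟩ := hz
    have hq' : (1 - t) • q + t • q = q := by rw [← add_smul, sub_add_cancel, one_smul]
    simpa only [Prod.smul_mk, Prod.mk_add_mk, hq'] using hseg t ht q hq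
  refine (CnormOn_le_ofReal fun i hi x hx => hmain k hpert hO hu hseg'
    (fun i hi z hz => norm_iteratedFDerivWithin_le_toReal_CnormOn huT hi hz) hx i hi).trans ?_
  have hC1 := zero_le_one.trans (hC k)
  have hA0 : 0 ≤ A := zero_le_one.trans hA1
  have hAof : ENNReal.ofReal A = 1 + CnormOn φ0 V' (k + 1) := by
    rw [hAdef, ENNReal.ofReal_add zero_le_one ENNReal.toReal_nonneg, ENNReal.ofReal_one,
      ENNReal.ofReal_toReal hA]
  rw [ENNReal.ofReal_mul (by positivity), ENNReal.ofReal_mul (by positivity),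
    ENNReal.ofReal_mul hC1, ENNReal.ofReal_pow hA0, ENNReal.ofReal_toReal hG,
    ENNReal.ofReal_toReal huT, hAof]
  gcongr
  · exact le_self_add
  · exact Nat.le_succ _
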